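/- Let σ and τ be two distinct matchings of Fin 6. If σ and τ share a pair (i.e. σ a = τ a for some a), then the subspace P_σ ⊓ P_τ of ℂ⁶ has dimension 2 (the two planes of the Segre cubic meet along a projective line); if σ and τ are disjoint, then P_σ ⊓ P_τ has dimension 1 (the two planes meet in a single projective point). -/

import Mathlib

/-- A matching of `Fin 6`: a fixed-point-free involution. -/
def IsMatching (σ : Equiv.Perm (Fin 6)) : Prop :=
  (∀ x, σ (σ x) = x) ∧ ∀ x, σ x ≠ x

/-- Two matchings are disjoint if they share no pair. -/
def DisjointMatchings (σ τ : Equiv.Perm (Fin 6)) : Prop :=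
  ∀ x, σ x ≠ τ x

/-- The linear subspace `P_σ = {x : Fin 6 → ℂ | ∀ a, x a + x (σ a) = 0}` of `ℂ⁶`
attached to a matching `σ` (one of the fifteen planes of the Segre cubic). -/
noncomputable def matchingPlane (σ : Equiv.Perm (Fin 6)) : Submodule ℂ (Fin 6 → ℂ) where
  carrier := {x | ∀ a, x a + x (σ a) = 0}
  add_mem' := by
    intro x y hx hy a
    simp only [Pi.add_apply]
    linear_combination hx a + hy a
  zero_mem' := by intro a; simp
  smul_mem' := by
    intro c x hx a
    simp only [Pi.smul_apply, smul_eq_mul]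
    linear_combination c * hx a

lemma inj6 (a b c d e f : Fin 6) (h : [a, b, c, d, e, f].Nodup) :
    Function.Bijective ![a, b, c, d, e, f] := by
  have : Function.Injective ![a, b, c, d, e, f] := by
    rw [← List.nodup_ofFn]
    simpa using h
  exact Finite.injective_iff_bijective.1 this

lemma not7 (l : List (Fin 6)) (hl : l.length = 7) (h : l.Nodup) : False := by
  have := h.length_le_card
  simp [hl] at this

lemma cover6 (a b c d e f : Fin 6) (h : [a, b, c, d, e, f].Nodup) (x : Fin 6) :
    x = a ∨ x = b ∨ x = c ∨ x = d ∨ x = e ∨ x = f := by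
  by_contra hx
  refine not7 (x :: [a, b, c, d, e, f]) rfl ?_
  rw [List.nodup_cons]
  exact ⟨by simpa using hx, h⟩

/-- Normal form when the matchings share a pair. -/
lemma normal_shared (σ τ : Equiv.Perm (Fin 6)) (hσ : IsMatching σ) (hτ : IsMatching τ)
    (hne : σ ≠ τ) (h : ∃ a, σ a = τ a) : ∃ e : Equiv.Perm (Fin 6),
      (∀ i, σ (e i) = e (![1,0,3,2,5,4] i)) ∧ (∀ i, τ (e i) = e (![1,0,5,4,3,2] i)) := by
  obtain ⟨a, ha⟩ := h
  obtain ⟨b, hb⟩ : ∃ b, σ b ≠ τ b := by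
    by_contra! hc
    exact hne (Equiv.ext hc)
  obtain ⟨s2, s1⟩ := hσ
  obtain ⟨t2, t1⟩ := hτ
  have nd : [a, σ a, b, σ b, σ (τ b), τ b].Nodup := by
    simp only [List.nodup_cons, List.mem_cons, List.not_mem_nil, or_false, not_or]
    grind
  have key : τ (σ b) = σ (τ b) := by
    have := cover6 _ _ _ _ _ _ nd (τ (σ b))
    simp only [List.nodup_cons, List.mem_cons, List.not_mem_nil, or_false, not_or] at nd
    grind
  refine ⟨Equiv.ofBijective _ (inj6 _ _ _ _ _ _ nd), ?_, ?_⟩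
  · intro i; fin_cases i <;> simp [s2]
  · intro i; fin_cases i <;> simp [t2, ha, ← key]

/-- Normal form when the matchings are disjoint: a hexagon. -/
lemma normal_disjoint (σ τ : Equiv.Perm (Fin 6)) (hσ : IsMatching σ) (hτ : IsMatching τ)
    (h : DisjointMatchings σ τ) : ∃ e : Equiv.Perm (Fin 6),
      (∀ i, σ (e i) = e (![1,0,3,2,5,4] i)) ∧ (∀ i, τ (e i) = e (![5,2,1,4,3,0] i)) := by
  obtain ⟨s2, s1⟩ := hσ
  obtain ⟨t2, t1⟩ := hτ
  unfold DisjointMatchings at h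
  obtain ⟨a, -⟩ : ∃ a : Fin 6, True := ⟨0, trivial⟩
  have hcomm : σ (τ a) ≠ τ (σ a) := by
    intro hc
    obtain ⟨x, hx⟩ : ∃ x, x ∉ ({a, σ a, τ a, σ (τ a)} : Finset (Fin 6)) := by
      by_contra! hall
      have h1 : (Finset.univ : Finset (Fin 6)) ⊆ {a, σ a, τ a, σ (τ a)} := fun x _ => hall x
      have h2 := Finset.card_le_card h1
      have h3 : ({a, σ a, τ a, σ (τ a)} : Finset (Fin 6)).card ≤ 4 := Finset.card_le_four
      simp only [Finset.card_univ, Fintype.card_fin] at h2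
      omega
    simp only [Finset.mem_insert, Finset.mem_singleton, not_or] at hx
    refine not7 [a, σ a, τ a, σ (τ a), x, σ x, τ x] rfl ?_
    simp only [List.nodup_cons, List.mem_cons, List.not_mem_nil, or_false, not_or]
    grind
  have nd : [a, σ a, τ (σ a), σ (τ (σ a)), σ (τ a), τ a].Nodup := by
    simp only [List.nodup_cons, List.mem_cons, List.not_mem_nil, or_false, not_or]
    grind
  have key : τ (σ (τ (σ a))) = σ (τ a) := by
    have := cover6 _ _ _ _ _ _ nd (τ (σ (τ (σ a))))
    simp only [List.nodup_cons, List.mem_cons, List.not_mem_nil, or_false, not_or] at nd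
    grind
  refine ⟨Equiv.ofBijective _ (inj6 _ _ _ _ _ _ nd), ?_, ?_⟩
  · intro i; fin_cases i <;> simp [s2]
  · intro i; fin_cases i <;> simp [t2, ← key]

lemma mem_iff (σ : Equiv.Perm (Fin 6)) (e : Equiv.Perm (Fin 6)) (s : Fin 6 → Fin 6)
    (hs : ∀ i, σ (e i) = e (s i)) (x : Fin 6 → ℂ) :
    x ∈ matchingPlane σ ↔ ∀ i, x (e i) + x (e (s i)) = 0 := by
  change (∀ a, x a + x (σ a) = 0) ↔ _
  rw [← e.forall_congr_right]
  simp only [hs]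

/-- Two distinct planes of the Segre cubic meet along a projective line (if the matchings
share a pair) or in a single projective point (if the matchings are disjoint). -/
theorem matching_planes_intersection (σ τ : Equiv.Perm (Fin 6))
    (hσ : IsMatching σ) (hτ : IsMatching τ) (hne : σ ≠ τ) :
    ((∃ a, σ a = τ a) →
        Module.finrank ℂ ↥(matchingPlane σ ⊓ matchingPlane τ) = 2) ∧
      (DisjointMatchings σ τ →
        Module.finrank ℂ ↥(matchingPlane σ ⊓ matchingPlane τ) = 1) := by
  constructor
  · intro h
    obtain ⟨e, hs, ht⟩ := normal_shared σ τ hσ hτ hne h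
    let f : ↥(matchingPlane σ ⊓ matchingPlane τ) →ₗ[ℂ] (Fin 2 → ℂ) :=
      (LinearMap.funLeft ℂ ℂ ![e 0, e 2]) ∘ₗ Submodule.subtype _
    have hf : Function.Bijective f := by
      constructor
      · rw [injective_iff_map_eq_zero]
        rintro ⟨x, hx1, hx2⟩ h0
        have hx1 := (mem_iff σ e _ hs x).1 hx1
        have hx2 := (mem_iff τ e _ ht x).1 hx2
        have h00 : x (e 0) = 0 := congrFun h0 0
        have h02 : x (e 2) = 0 := congrFun h0 1
        simp [Fin.forall_fin_succ] at hx1 hx2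
        ext j
        obtain ⟨i, rfl⟩ := e.surjective j
        fin_cases i <;> simp <;> grind
      · intro v
        refine ⟨⟨fun j => ![v 0, -v 0, v 1, -v 1, v 1, -v 1] (e.symm j), ?_, ?_⟩, ?_⟩
        · refine (mem_iff σ e _ hs _).2 fun i => ?_
          fin_cases i <;> simp
        · refine (mem_iff τ e _ ht _).2 fun i => ?_
          fin_cases i <;> simp
        · ext i
          fin_cases i <;> simp [f, LinearMap.funLeft_apply]
    rw [(LinearEquiv.ofBijective f hf).finrank_eq]
    simp
  · intro h
    obtain ⟨e, hs, ht⟩ := normal_disjoint σ τ hσ hτ h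
    let f : ↥(matchingPlane σ ⊓ matchingPlane τ) →ₗ[ℂ] (Fin 1 → ℂ) :=
      (LinearMap.funLeft ℂ ℂ ![e 0]) ∘ₗ Submodule.subtype _
    have hf : Function.Bijective f := by
      constructor
      · rw [injective_iff_map_eq_zero]
        rintro ⟨x, hx1, hx2⟩ h0
        have hx1 := (mem_iff σ e _ hs x).1 hx1
        have hx2 := (mem_iff τ e _ ht x).1 hx2
        have h00 : x (e 0) = 0 := congrFun h0 0
        simp [Fin.forall_fin_succ] at hx1 hx2
        ext j
        obtain ⟨i, rfl⟩ := e.surjective j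
        fin_cases i <;> simp <;> grind
      · intro v
        refine ⟨⟨fun j => ![v 0, -v 0, v 0, -v 0, v 0, -v 0] (e.symm j), ?_, ?_⟩, ?_⟩
        · refine (mem_iff σ e _ hs _).2 fun i => ?_
          fin_cases i <;> simp
        · refine (mem_iff τ e _ ht _).2 fun i => ?_
          fin_cases i <;> simp
        · ext i
          fin_cases i; simp [f, LinearMap.funLeft_apply]
    rw [(LinearEquiv.ofBijective f hf).finrank_eq]
    simp
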